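/- Let u : ℝ → ℝ be continuous with exactly two zeroes q⁻ < q⁺, with u < 0 on (q⁻,q⁺) and u > 0 outside [q⁻,q⁺], and assume u is C¹ near q± with u'(q⁺) > 0, u'(q⁻) < 0, and u grows at least linearly at ±∞. Then for T > 0, the function λ ↦ log(1 + e^{−u(λ)/T}) is integrable on ℝ, and T·∫_ℝ log(1+e^{−u(λ)/T}) dλ = −∫_{q⁻}^{q⁺} u(λ) dλ + (π²T²/6)·(1/u'(q⁺) − 1/u'(q⁻)) + o(T²) as T → 0⁺. -/

import Mathlib

open MeasureTheory Asymptotics Set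
open Filter Topology


noncomputable def gg (y : ℝ) : ℝ := Real.log (1 + Real.exp (-|y|))

lemma gg_nonneg (y : ℝ) : 0 ≤ gg y :=
  Real.log_nonneg (by linarith [Real.exp_pos (-|y|)])

lemma gg_le (y : ℝ) : gg y ≤ Real.exp (-|y|) := by
  have := Real.log_le_sub_one_of_pos (x := 1 + Real.exp (-|y|)) (by positivity)
  unfold gg; linarith

lemma gg_cont : Continuous gg := by
  unfold gg
  refine Continuous.log (by fun_prop) (fun y => by positivity)

lemma int_exp_abs {k : ℝ} (hk : 0 < k) : Integrable (fun x : ℝ => Real.exp (-(k * |x|))) := by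
  apply Integrable.of_integral_ne_zero
  rw [integral_comp_abs (f := fun x => Real.exp (-(k * x)))]
  have := integral_exp_mul_Ioi (a := -k) (by linarith) 0
  simp only [neg_mul] at this
  rw [this]
  simp [hk.ne']

lemma int_bose : ∫ x in Ioi (0:ℝ), -Real.log (1 - Real.exp (-x)) = Real.pi ^ 2 / 6 := by
  have hi : ∀ n : ℕ, ∫ x in Ioi (0:ℝ), Real.exp (-((n:ℝ)+1) * x) / (n+1) = 1 / ((n:ℝ)+1)^2 := by
    intro n
    rw [integral_div, integral_exp_mul_Ioi (by linarith [n.cast_nonneg (α := ℝ)])]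
    have h0 : (n:ℝ) + 1 ≠ 0 := by positivity
    rw [mul_zero, Real.exp_zero, neg_div_neg_eq, div_div, sq]
  have hs : HasSum (fun n : ℕ => 1 / ((n:ℝ)+1)^2) (Real.pi^2/6) := by
    have := (hasSum_nat_add_iff' 1).2 hasSum_zeta_two
    simpa using this
  have h := hasSum_integral_of_summable_integral_norm (μ := volume.restrict (Ioi (0:ℝ)))
    (F := fun (n : ℕ) (x : ℝ) => Real.exp (-((n:ℝ)+1) * x) / (n+1)) ?_ ?_
  · simp only [hi] at h
    rw [← h.unique hs]
    refine setIntegral_congr_fun measurableSet_Ioi (fun x hx => ?_)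
    have hx' : (0:ℝ) < x := hx
    have h1 := Real.hasSum_pow_div_log_of_abs_lt_one (x := Real.exp (-x))
      (by rw [abs_of_pos (Real.exp_pos _)]; exact Real.exp_lt_one_iff.2 (by linarith))
    rw [← h1.tsum_eq]
    refine tsum_congr (fun n => ?_)
    rw [← Real.exp_nat_mul]
    congr 2; push_cast; ring
  · intro n
    exact (integrableOn_exp_mul_Ioi (by linarith [n.cast_nonneg (α := ℝ)]) 0).div_const _
  · have : ∀ n : ℕ, ∀ x : ℝ, ‖Real.exp (-((n:ℝ)+1) * x) / (n+1)‖ = Real.exp (-((n:ℝ)+1) * x) / (n+1) :=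
      fun n x => Real.norm_of_nonneg (by positivity)
    simp only [this, hi]
    exact hs.summable

lemma int_fermi : ∫ x in Ioi (0:ℝ), Real.log (1 + Real.exp (-x)) = Real.pi ^ 2 / 12 := by
  have h1 := int_bose
  have h2 := integral_comp_mul_left_Ioi (fun x => -Real.log (1 - Real.exp (-x))) 0 (b := 2) (by norm_num)
  simp only [mul_zero, h1, smul_eq_mul] at h2
  have i1 : IntegrableOn (fun x:ℝ => -Real.log (1 - Real.exp (-x))) (Ioi 0) :=
    Integrable.of_integral_ne_zero (by rw [h1]; positivity)
  have i2 : IntegrableOn (fun x:ℝ => -Real.log (1 - Real.exp (-(2*x)))) (Ioi 0) :=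
    Integrable.of_integral_ne_zero (by rw [h2]; positivity)
  have h3 := integral_sub i1 i2
  rw [h1, h2] at h3
  have : Real.pi ^ 2 / 12 = Real.pi^2/6 - 2⁻¹ * (Real.pi^2/6) := by ring
  rw [this, ← h3]
  refine setIntegral_congr_fun measurableSet_Ioi (fun x hx => ?_)
  have hx' : (0:ℝ) < x := hx
  have hlt : Real.exp (-x) < 1 := Real.exp_lt_one_iff.2 (by linarith)
  have hp := Real.exp_pos (-x)
  have : 1 - Real.exp (-(2*x)) = (1 - Real.exp (-x)) * (1 + Real.exp (-x)) := by
    have : Real.exp (-(2*x)) = Real.exp (-x) * Real.exp (-x) := by rw [← Real.exp_add]; ring_nf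
    rw [this]; ring
  simp only [this]
  rw [Real.log_mul (by linarith) (by linarith)]
  ring

lemma int_gg {d : ℝ} : ∫ y, gg (d * y) = |d⁻¹| * (Real.pi ^ 2 / 6) := by
  rw [Measure.integral_comp_mul_left gg d]
  unfold gg
  rw [integral_comp_abs (f := fun x => Real.log (1 + Real.exp (-x))), int_fermi, smul_eq_mul]
  ring

lemma exists_lower (u : ℝ → ℝ) (q d : ℝ) (S : Set ℝ) (hS : IsClosed S)
    (hcont : Continuous u) (hz : u q = 0) (hd : HasDerivAt u d q) (hd0 : d ≠ 0)
    (hne : ∀ x ∈ S, x ≠ q → u x ≠ 0)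
    (hgrow : ∃ c > (0 : ℝ), ∃ R : ℝ, ∀ x : ℝ, R ≤ |x| → c * |x| ≤ u x) :
    ∃ k > 0, ∀ x ∈ S, k * |x - q| ≤ |u x| := by
  obtain ⟨c, hc, R, hR⟩ := hgrow
  have hcd : ContinuousOn (fun x => |dslope u q x|) (S ∩ Icc (-(max R |q|)) (max R |q|)) := by
    refine ContinuousOn.abs ?_
    refine ContinuousOn.mono ?_ (subset_univ _)
    exact (continuousOn_dslope univ_mem).2 ⟨hcont.continuousOn, hd.differentiableAt⟩
  have hcomp : IsCompact (S ∩ Icc (-(max R |q|)) (max R |q|)) := isCompact_Icc.inter_left hS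
  have hkey : ∀ x, (x - q) * dslope u q x = u x := by
    intro x
    have := sub_smul_dslope u q x
    simpa [hz] using this
  obtain ⟨k, hk, hk'⟩ := hcomp.exists_forall_le' hcd (a := 0) (by
    rintro x ⟨hx, -⟩
    rw [abs_pos]
    rcases eq_or_ne x q with rfl | hxq
    · rw [dslope_same, hd.deriv]; exact hd0
    · intro h0
      apply hne x hx hxq
      rw [← hkey, h0, mul_zero])
  refine ⟨min k (c/2), by positivity, fun x hx => ?_⟩
  by_cases hxx : |x| ≤ max R |q|
  · have := hk' x ⟨hx, abs_le.1 hxx⟩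
    rw [← hkey x, abs_mul, mul_comm]
    gcongr
    exact (min_le_left _ _).trans this
  · push Not at hxx
    have h1 := hR x ((le_max_left _ _).trans hxx.le)
    have h2 : |q| ≤ |x| := (le_max_right _ _).trans hxx.le
    have h3 : |x - q| ≤ 2 * |x| := (abs_sub x q).trans (by linarith)
    calc min k (c/2) * |x - q| ≤ c/2 * (2 * |x|) := by gcongr; exact min_le_right _ _
      _ = c * |x| := by ring
      _ ≤ u x := h1
      _ ≤ _ := le_abs_self _

lemma local_int (u : ℝ → ℝ) (q k : ℝ) (S : Set ℝ) (hS : MeasurableSet S)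
    (hcont : Continuous u) (hk : 0 < k) (hlow : ∀ x ∈ S, k * |x - q| ≤ |u x|) (T : ℝ) (hT : 0 < T) :
    IntegrableOn (fun x => gg (u x / T)) S := by
  have h := ((int_exp_abs (k := k / T) (by positivity)).comp_sub_right q).integrableOn (s := S)
  refine Integrable.mono' h (gg_cont.comp (hcont.div_const T)).aestronglyMeasurable ?_
  filter_upwards [ae_restrict_mem hS] with x hx
  rw [Real.norm_of_nonneg (gg_nonneg _)]
  refine (gg_le _).trans (Real.exp_le_exp.2 (neg_le_neg ?_))
  rw [abs_div, abs_of_pos hT, div_mul_eq_mul_div]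
  gcongr
  exact hlow x hx

lemma local_lim (u : ℝ → ℝ) (q d k : ℝ) (S : Set ℝ) (hS : MeasurableSet S) (hSq : S ∈ 𝓝 q)
    (hcont : Continuous u) (hz : u q = 0) (hd : HasDerivAt u d q) (hd0 : d ≠ 0)
    (hk : 0 < k) (hlow : ∀ x ∈ S, k * |x - q| ≤ |u x|) :
    Tendsto (fun T => T⁻¹ * ∫ x in S, gg (u x / T)) (𝓝[>] 0) (𝓝 (|d⁻¹| * (Real.pi ^ 2 / 6))) := by
  rw [← int_gg]
  have hev : (fun T => ∫ y, S.indicator (fun x => gg (u x / T)) (q + T * y)) =ᶠ[𝓝[>] 0]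
      (fun T => T⁻¹ * ∫ x in S, gg (u x / T)) := by
    filter_upwards [self_mem_nhdsWithin] with T hT
    have hT' : (0:ℝ) < T := hT
    rw [Measure.integral_comp_mul_left (fun z => S.indicator (fun x => gg (u x / T)) (q + z)) T,
      integral_add_left_eq_self (fun z => S.indicator (fun x => gg (u x / T)) z) q,
      integral_indicator hS, abs_of_pos (by positivity), smul_eq_mul]
  refine Tendsto.congr' hev ?_
  refine tendsto_integral_filter_of_dominated_convergence (fun y => Real.exp (-(k * |y|))) ?_ ?_
    (int_exp_abs hk) ?_
  · refine Eventually.of_forall (fun T => ?_)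
    have : Measurable (S.indicator (fun x => gg (u x / T))) :=
      (gg_cont.comp (hcont.div_const T)).measurable.indicator hS
    exact (this.comp (by fun_prop : Measurable fun y : ℝ => q + T * y)).aestronglyMeasurable
  · filter_upwards [self_mem_nhdsWithin] with T hT
    have hT' : (0:ℝ) < T := hT
    refine Eventually.of_forall (fun y => ?_)
    by_cases hy : q + T * y ∈ S
    · rw [indicator_of_mem hy, Real.norm_of_nonneg (gg_nonneg _)]
      refine (gg_le _).trans (Real.exp_le_exp.2 (neg_le_neg ?_))
      have := hlow _ hy
      rw [add_sub_cancel_left, abs_mul, abs_of_pos hT'] at this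
      rw [abs_div, abs_of_pos hT', le_div_iff₀ hT']
      linarith
    · rw [indicator_of_notMem hy]; simp; positivity
  · refine Eventually.of_forall (fun y => ?_)
    have hlin : HasDerivAt (fun T : ℝ => q + T * y) y 0 := by
      simpa using ((hasDerivAt_id (0:ℝ)).mul_const y).const_add q
    have hq0 : q + 0 * y = q := by ring
    have hcomp : HasDerivAt (fun T : ℝ => u (q + T * y)) (d * y) 0 :=
      HasDerivAt.comp (h₂ := u) (h := fun T : ℝ => q + T * y) 0 (by rw [hq0]; exact hd) hlin
    have hsl := hcomp.tendsto_slope_zero_right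
    simp only [zero_add, zero_mul, add_zero, hz, sub_zero, smul_eq_mul] at hsl
    have hg := (gg_cont.tendsto (d * y)).comp hsl
    refine hg.congr' ?_
    have hmem : ∀ᶠ T in 𝓝[>] (0:ℝ), q + T * y ∈ S := by
      have : Tendsto (fun T : ℝ => q + T * y) (𝓝[>] 0) (𝓝 q) := by
        have := hlin.continuousAt.tendsto
        rw [hq0] at this
        exact this.mono_left nhdsWithin_le_nhds
      exact this hSq
    filter_upwards [hmem] with T hT
    rw [indicator_of_mem hT, Function.comp_apply]
    congr 1; rw [div_eq_inv_mul]

lemma log_split (y : ℝ) : Real.log (1 + Real.exp (-y)) = max (-y) 0 + gg y := by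
  unfold gg
  rcases le_total 0 y with h | h
  · rw [max_eq_right (by linarith), abs_of_nonneg h]; ring
  · rw [max_eq_left (by linarith), abs_of_nonpos h, neg_neg]
    have : 1 + Real.exp (-y) = Real.exp (-y) * (1 + Real.exp y) := by
      rw [mul_add, ← Real.exp_add]; simp [add_comm]
    rw [this, Real.log_mul (by positivity) (by positivity), Real.log_exp]

theorem stmt14 (u : ℝ → ℝ) (qm qp : ℝ) (hq : qm < qp)
    (hcont : Continuous u) (hzm : u qm = 0) (hzp : u qp = 0)
    (hneg : ∀ x ∈ Ioo qm qp, u x < 0)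
    (hpos : ∀ x, x < qm ∨ qp < x → 0 < u x)
    (hC1 : ∃ δ > (0 : ℝ), ContDiffOn ℝ 1 u (Metric.ball qm δ ∪ Metric.ball qp δ))
    (hdp : 0 < deriv u qp) (hdm : deriv u qm < 0)
    (hgrow : ∃ c > (0 : ℝ), ∃ R : ℝ, ∀ x : ℝ, R ≤ |x| → c * |x| ≤ u x) :
    (∀ T : ℝ, 0 < T → Integrable (fun x => Real.log (1 + Real.exp (-u x / T)))) ∧
    (fun T : ℝ =>
        T * (∫ x, Real.log (1 + Real.exp (-u x / T)))
        + (∫ x in qm..qp, u x)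
        - (Real.pi ^ 2 * T ^ 2 / 6) * (1 / deriv u qp - 1 / deriv u qm))
      =o[nhdsWithin 0 (Ioi 0)] (fun T => T ^ 2) := by
  have hDp : HasDerivAt u (deriv u qp) qp :=
    (differentiableAt_of_deriv_ne_zero hdp.ne').hasDerivAt
  have hDm : HasDerivAt u (deriv u qm) qm :=
    (differentiableAt_of_deriv_ne_zero hdm.ne).hasDerivAt
  obtain ⟨m, hm1, hm2⟩ := exists_between hq
  have hne : ∀ x, x ≠ qm → x ≠ qp → u x ≠ 0 := by
    intro x h1 h2
    rcases lt_or_gt_of_ne h1 with h | h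
    · exact (hpos x (Or.inl h)).ne'
    · rcases lt_or_gt_of_ne h2 with h' | h'
      · exact (hneg x ⟨h, h'⟩).ne
      · exact (hpos x (Or.inr h')).ne'
  obtain ⟨kp, hkp, hlp⟩ := exists_lower u qp _ (Ici m) isClosed_Ici hcont hzp hDp hdp.ne'
    (fun x hx h => hne x (by rintro rfl; have : m ≤ x := hx; linarith) h) hgrow
  obtain ⟨km, hkm, hlm⟩ := exists_lower u qm _ (Iic m) isClosed_Iic hcont hzm hDm hdm.ne
    (fun x hx h => hne x h (by rintro rfl; have : x ≤ m := hx; linarith)) hgrow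
  have ip := local_int u qp kp (Ici m) measurableSet_Ici hcont hkp hlp
  have im := local_int u qm km (Iic m) measurableSet_Iic hcont hkm hlm
  have lp := local_lim u qp _ kp (Ici m) measurableSet_Ici (Ici_mem_nhds hm2) hcont hzp hDp hdp.ne' hkp hlp
  have lm := local_lim u qm _ km (Iic m) measurableSet_Iic (Iic_mem_nhds hm1) hcont hzm hDm hdm.ne hkm hlm
  have hig : ∀ T : ℝ, 0 < T → Integrable (fun x => gg (u x / T)) := by
    intro T hT
    have := (im T hT).union (ip T hT)
    rwa [Iic_union_Ici, integrableOn_univ] at this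
  have hmax : ∀ T : ℝ, 0 < T → (fun x => max (-(u x / T)) 0) =
      (Ioc qm qp).indicator (fun x => - (u x / T)) := by
    intro T hT
    funext x
    by_cases hx : x ∈ Ioc qm qp
    · rw [indicator_of_mem hx, max_eq_left]
      have : u x ≤ 0 := by
        rcases eq_or_lt_of_le hx.2 with h | h
        · rw [h, hzp]
        · exact (hneg x ⟨hx.1, h⟩).le
      have := div_nonpos_of_nonpos_of_nonneg this hT.le
      linarith
    · rw [indicator_of_notMem hx, max_eq_right]
      have : 0 ≤ u x := by
        by_cases h1 : qm < x
        · exact (hpos x (Or.inr (by by_contra h; exact hx ⟨h1, not_lt.1 h⟩))).le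
        · rcases eq_or_lt_of_le (not_lt.1 h1) with h | h
          · rw [h, hzm]
          · exact (hpos x (Or.inl h)).le
      have := div_nonneg this hT.le
      linarith
  have himax : ∀ T : ℝ, 0 < T → Integrable (fun x => max (-(u x / T)) 0) := by
    intro T hT
    rw [hmax T hT, integrable_indicator_iff measurableSet_Ioc]
    exact ((hcont.div_const T).neg.integrableOn_Icc).mono_set Ioc_subset_Icc_self
  have hfun : ∀ T : ℝ, (fun x => Real.log (1 + Real.exp (-u x / T))) =
      fun x => max (-(u x / T)) 0 + gg (u x / T) := by
    intro T; funext x; rw [neg_div, log_split]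
  refine ⟨fun T hT => ?_, ?_⟩
  · rw [hfun T]; exact (himax T hT).add (hig T hT)
  have hlim := ((lp.add lm).sub_const
    (|(deriv u qp)⁻¹| * (Real.pi ^ 2 / 6) + |(deriv u qm)⁻¹| * (Real.pi ^ 2 / 6)))
  rw [sub_self] at hlim
  have hnz : ∀ᶠ T : ℝ in 𝓝[>] 0, T ^ 2 = 0 → T * (∫ x, Real.log (1 + Real.exp (-u x / T)))
        + (∫ x in qm..qp, u x)
        - (Real.pi ^ 2 * T ^ 2 / 6) * (1 / deriv u qp - 1 / deriv u qm) = 0 := by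
    filter_upwards [self_mem_nhdsWithin] with T hT h
    have hT' : (0:ℝ) < T := hT
    exact absurd h (by positivity)
  rw [isLittleO_iff_tendsto' hnz]
  refine hlim.congr' ?_
  filter_upwards [self_mem_nhdsWithin] with T hT
  have hT' : (0:ℝ) < T := hT
  rw [hfun T, integral_add (himax T hT') (hig T hT'), hmax T hT', integral_indicator measurableSet_Ioc,
    ← intervalIntegral.integral_of_le hq.le, intervalIntegral.integral_neg,
    intervalIntegral.integral_div,
    ← intervalIntegral.integral_Iic_add_Ioi (im T hT') ((ip T hT').mono_set Ioi_subset_Ici_self),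
    integral_Ici_eq_integral_Ioi, abs_of_pos (inv_pos.2 hdp), abs_of_neg (inv_lt_zero.2 hdm)]
  have := hdp.ne'
  have := hdm.ne
  field_simp
  ring
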